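/- arXiv:2402.10474 — 2 statements merged into one kernel-verified Lean document; each statement's English description precedes it below -/
import Mathlib

section
/- Let X be a standard Gaussian random vector in ℝ^d (mean 0, identity covariance), let a ∈ ℝ^d, c ∈ ℝ, and let f : ℝ^d → ℝ be continuously differentiable with f(x) = 0 for every x with ⟨a, x⟩ = c, and assume f and all its first-order partial derivatives have at most polynomial growth. Then E[X₁ · f(X) · 1{⟨a, X⟩ ≥ c}] = E[1{⟨a, X⟩ ≥ c} · ∂f/∂x₁(X)]. -/
open MeasureTheory ProbabilityTheory

lemma integrable_gaussianReal_zero_one_iff {h : ℝ → ℝ} :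
    Integrable h (gaussianReal 0 1) ↔ Integrable (fun t => h t * gaussianPDFReal 0 1 t) := by
  rw [gaussianReal_of_var_ne_zero 0 one_ne_zero,
    integrable_withDensity_iff_integrable_smul' (measurable_gaussianPDF 0 1)
      (ae_of_all _ fun _ => gaussianPDF_lt_top)]
  simp [toReal_gaussianPDF, mul_comm]

lemma hasDerivAt_gaussianPDFReal_zero_one (t : ℝ) :
    HasDerivAt (gaussianPDFReal 0 1) (-t * gaussianPDFReal 0 1 t) t := by
  rw [gaussianPDFReal_def]
  have h : HasDerivAt (fun s : ℝ => -(s - 0) ^ 2 / (2 * ((1 : NNReal) : ℝ))) (-t) t := by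
    have := (((hasDerivAt_id t).sub_const 0).pow 2).neg.div_const (2 * ((1 : NNReal) : ℝ))
    refine this.congr_deriv ?_
    simp [neg_div]
  refine (h.exp.const_mul _).congr_deriv ?_
  ring

/-- Gaussian integration by parts on a half-line `{t | c ≤ α * t + b}`, possibly degenerate, for a
function vanishing on the boundary. -/
lemma setIntegral_gaussianReal_deriv_sub_id_mul {g g' : ℝ → ℝ} (α b c : ℝ)
    (hg : ∀ t, HasDerivAt g (g' t) t) (hg0 : ∀ t, α * t + b = c → g t = 0)
    (hint : Integrable g (gaussianReal 0 1))
    (hint' : Integrable (fun t => g' t - t * g t) (gaussianReal 0 1)) :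
    ∫ t in {t | c ≤ α * t + b}, (g' t - t * g t) ∂(gaussianReal 0 1) = 0 := by
  have hS : MeasurableSet {t : ℝ | c ≤ α * t + b} := measurableSet_le (by fun_prop) (by fun_prop)
  have hF : ∀ t, HasDerivAt (fun t => g t * gaussianPDFReal 0 1 t)
      ((g' t - t * g t) * gaussianPDFReal 0 1 t) t := fun t =>
    ((hg t).mul (hasDerivAt_gaussianPDFReal_zero_one t)).congr_deriv (by ring)
  rw [integrable_gaussianReal_zero_one_iff] at hint hint'
  have key : ∫ t in {t | c ≤ α * t + b}, (g' t - t * g t) * gaussianPDFReal 0 1 t = 0 := by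
    rcases lt_trichotomy α 0 with hα | rfl | hα
    · have hs : {t | c ≤ α * t + b} = Set.Iic ((c - b) / α) := by
        ext t
        simp only [Set.mem_ofPred_eq, Set.mem_Iic, le_div_iff_of_neg hα]
        constructor <;> intro h <;> linarith
      rw [hs, integral_Iic_of_hasDerivAt_of_tendsto' (fun t _ => hF t) hint'.integrableOn
        (tendsto_zero_of_hasDerivAt_of_integrableOn_Iic (a := 0) (fun t _ => hF t)
          hint'.integrableOn hint.integrableOn),
        hg0 _ (by rw [mul_div_cancel₀ _ hα.ne]; ring)]
      simp
    · by_cases hc : c ≤ b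
      · simpa [hc] using integral_eq_zero_of_hasDerivAt_of_integrable hF hint' hint
      · simp [hc]
    · have hs : {t | c ≤ α * t + b} = Set.Ici ((c - b) / α) := by
        ext t
        simp only [Set.mem_ofPred_eq, Set.mem_Ici, div_le_iff₀ hα]
        constructor <;> intro h <;> linarith
      rw [hs, integral_Ici_eq_integral_Ioi,
        integral_Ioi_of_hasDerivAt_of_tendsto' (fun t _ => hF t) hint'.integrableOn
        (tendsto_zero_of_hasDerivAt_of_integrableOn_Ioi (a := 0) (fun t _ => hF t)
          hint'.integrableOn hint.integrableOn),
        hg0 _ (by rw [mul_div_cancel₀ _ hα.ne']; ring)]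
      simp
  rw [← integral_indicator hS] at key ⊢
  rw [integral_gaussianReal_eq_integral_smul one_ne_zero]
  refine Eq.trans ?_ key
  congr 1 with t
  by_cases ht : c ≤ α * t + b <;> simp [ht, mul_comm]

/-- A function of at most polynomial growth is integrable for the standard Gaussian measure. -/
lemma integrable_pi_gaussianReal_of_growth {d : ℕ} {h : (Fin d → ℝ) → ℝ} (hh : Continuous h)
    {C : ℝ} {m : ℕ} (hb : ∀ x, |h x| ≤ C * (1 + Real.sqrt (∑ i, (x i) ^ 2)) ^ m) :
    Integrable h (Measure.pi fun _ : Fin d => gaussianReal 0 1) := by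
  have hmem : MemLp (fun x : Fin d → ℝ => 1 + ∑ i, |x i|) m
      (Measure.pi fun _ : Fin d => gaussianReal 0 1) := by
    have hi (i : Fin d) : MemLp (fun x : Fin d → ℝ => |x i|) m
        (Measure.pi fun _ : Fin d => gaussianReal 0 1) :=
      ((memLp_id_gaussianReal' m (ENNReal.natCast_ne_top m)).comp_measurePreserving
        (measurePreserving_eval (fun _ : Fin d => gaussianReal 0 1) i)).norm
    have hsum := memLp_finsetSum Finset.univ fun i _ => hi i
    exact (memLp_const (1 : ℝ)).add hsum
  refine (hmem.integrable_norm_pow'.const_mul |C|).mono' hh.aestronglyMeasurable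
    (ae_of_all _ fun x => ?_)
  have hsqrt : Real.sqrt (∑ i, (x i) ^ 2) ≤ ∑ i, |x i| := by
    refine Real.sqrt_le_iff.2 ⟨by positivity, ?_⟩
    simpa using Finset.sum_sq_le_sq_sum_of_nonneg (s := Finset.univ) (f := fun i => |x i|)
      (fun i _ => abs_nonneg _)
  rw [Real.norm_eq_abs, Real.norm_of_nonneg (by positivity)]
  refine (hb x).trans ?_
  gcongr
  exact le_abs_self C

lemma hasDerivAt_comp_finCons {n : ℕ} {f : (Fin (n + 1) → ℝ) → ℝ} (hf : Differentiable ℝ f)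
    (y : Fin n → ℝ) (t : ℝ) :
    HasDerivAt (fun s : ℝ => f (Fin.cons s y))
      (fderiv ℝ f (Fin.cons t y) (Pi.single 0 1)) t := by
  have hl : HasDerivAt (fun s : ℝ => (Fin.cons s y : Fin (n + 1) → ℝ)) (Pi.single 0 1) t := by
    refine hasDerivAt_pi.2 fun i => ?_
    refine Fin.cases ?_ (fun j => ?_) i
    · simpa using hasDerivAt_id' t
    · simpa using hasDerivAt_const t (y j)
  exact (hf _).hasFDerivAt.comp_hasDerivAt t hl

theorem stmt10 (d : ℕ) (hd : 0 < d) (a : Fin d → ℝ) (c : ℝ)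
    (f : (Fin d → ℝ) → ℝ) (hf : ContDiff ℝ 1 f)
    (hf0 : ∀ x : Fin d → ℝ, (∑ i, a i * x i) = c → f x = 0)
    (hgrowth : ∃ C : ℝ, ∃ m : ℕ, ∀ x : Fin d → ℝ,
      |f x| ≤ C * (1 + Real.sqrt (∑ i, (x i) ^ 2)) ^ m)
    (hgrowth' : ∀ j : Fin d, ∃ C : ℝ, ∃ m : ℕ, ∀ x : Fin d → ℝ,
      |fderiv ℝ f x (Pi.single j 1)| ≤ C * (1 + Real.sqrt (∑ i, (x i) ^ 2)) ^ m) :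
    ∫ x : Fin d → ℝ,
        x ⟨0, hd⟩ * f x * (if c ≤ ∑ i, a i * x i then (1 : ℝ) else 0)
        ∂(Measure.pi fun _ : Fin d => gaussianReal 0 1)
      = ∫ x : Fin d → ℝ,
          (if c ≤ ∑ i, a i * x i then (1 : ℝ) else 0) * fderiv ℝ f x (Pi.single ⟨0, hd⟩ 1)
          ∂(Measure.pi fun _ : Fin d => gaussianReal 0 1) := by
  obtain ⟨n, rfl⟩ : ∃ n, d = n + 1 := ⟨d - 1, by omega⟩
  change ∫ x : Fin (n + 1) → ℝ, x 0 * f x * _ ∂_ = ∫ x : Fin (n + 1) → ℝ,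
    _ * fderiv ℝ f x (Pi.single 0 1) ∂_
  set μ := Measure.pi fun _ : Fin (n + 1) => gaussianReal 0 1
  set A : Set (Fin (n + 1) → ℝ) := {x | c ≤ ∑ i, a i * x i} with hA
  have hAm : MeasurableSet A := measurableSet_le (by fun_prop) (by fun_prop)
  have hf'c : Continuous fun x => fderiv ℝ f x (Pi.single 0 1) :=
    (hf.continuous_fderiv one_ne_zero).clm_apply continuous_const
  have hfi : Integrable f μ := by
    obtain ⟨C, m, hb⟩ := hgrowth
    exact integrable_pi_gaussianReal_of_growth hf.continuous hb
  have hf'i : Integrable (fun x => fderiv ℝ f x (Pi.single 0 1)) μ := by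
    obtain ⟨C, m, hb⟩ := hgrowth' 0
    exact integrable_pi_gaussianReal_of_growth hf'c hb
  have hxfi : Integrable (fun x => x 0 * f x) μ := by
    obtain ⟨C, m, hb⟩ := hgrowth
    refine integrable_pi_gaussianReal_of_growth (C := C) (m := m + 1)
      ((continuous_apply 0).mul hf.continuous) fun x => ?_
    have hx : |x 0| ≤ 1 + Real.sqrt (∑ i, (x i) ^ 2) := by
      have : |x 0| ≤ Real.sqrt (∑ i, (x i) ^ 2) := Real.abs_le_sqrt
        (Finset.single_le_sum (f := fun i => x i ^ 2) (fun i _ => sq_nonneg _)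
          (Finset.mem_univ 0))
      linarith
    rw [abs_mul, pow_succ, ← mul_assoc, mul_comm]
    exact mul_le_mul (hb x) hx (abs_nonneg _) ((abs_nonneg _).trans (hb x))
  have hD : Integrable (fun x => fderiv ℝ f x (Pi.single 0 1) - x 0 * f x) μ := hf'i.sub hxfi
  have hmp := (measurePreserving_piFinSuccAbove (fun _ : Fin (n + 1) => gaussianReal 0 1) 0).symm
  have hcons : ∀ p : ℝ × (Fin n → ℝ),
      (MeasurableEquiv.piFinSuccAbove (fun _ : Fin (n + 1) => ℝ) 0).symm p = Fin.cons p.1 p.2 := by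
    intro p
    simp [MeasurableEquiv.piFinSuccAbove, Fin.insertNthEquiv]
  have slice : ∀ {h : (Fin (n + 1) → ℝ) → ℝ}, Integrable h μ →
      Integrable (fun p : ℝ × (Fin n → ℝ) => h (Fin.cons p.1 p.2))
        ((gaussianReal 0 1).prod (Measure.pi fun _ : Fin n => gaussianReal 0 1)) := by
    intro h hh
    have := hmp.integrable_comp_of_integrable hh
    simpa only [Function.comp_def, hcons] using this
  have key : ∫ x in A, (fderiv ℝ f x (Pi.single 0 1) - x 0 * f x) ∂μ = 0 := by
    rw [← integral_indicator hAm, ← hmp.integral_comp']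
    simp only [hcons]
    rw [integral_prod_symm _ (slice (hD.indicator hAm))]
    refine integral_eq_zero_of_ae ?_
    filter_upwards [(slice hfi).prod_left_ae, (slice hD).prod_left_ae] with y h1 h2
    have h := setIntegral_gaussianReal_deriv_sub_id_mul (a 0) (∑ i : Fin n, a i.succ * y i) c
      (fun t => hasDerivAt_comp_finCons (hf.differentiable one_ne_zero) y t)
      (fun t ht => hf0 _ (by simpa [Fin.sum_univ_succ] using ht)) h1 (by simpa using h2)
    rw [← integral_indicator (measurableSet_le (by fun_prop) (by fun_prop))] at h
    refine Eq.trans ?_ h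
    congr 1 with t
    simp [Set.indicator_apply, hA, Fin.sum_univ_succ]
  rw [integral_sub hf'i.integrableOn hxfi.integrableOn, sub_eq_zero, ← integral_indicator hAm,
    ← integral_indicator hAm] at key
  convert key.symm using 3 with x x
  · simp [Set.indicator_apply, hA]
  · simp [Set.indicator_apply, hA]
end

section
/- Let R be a symmetric positive definite d×d real matrix and let X be a Gaussian random vector in ℝ^d with mean 0 and covariance R. Let a ∈ ℝ^d, c ∈ ℝ, and let f : ℝ^d → ℝ be continuously differentiable with f(x) = 0 for every x with ⟨a, x⟩ = c, and assume f and all its first-order partial derivatives have at most polynomial growth. Then E[X₁ · f(X) · 1{⟨a, X⟩ ≥ c}] = Σ_{i=1}^d R_{1i} · E[1{⟨a, X⟩ ≥ c} · ∂f/∂x_i(X)], where R_{1i} = E[X₁ X_i]. -/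
open MeasureTheory

/-- The centered multivariate Gaussian measure on `ℝ^d` with covariance matrix `R`,
defined via its density with respect to Lebesgue measure. -/
noncomputable def gaussianOfCov (d : ℕ) (R : Matrix (Fin d) (Fin d) ℝ) :
    Measure (Fin d → ℝ) :=
  volume.withDensity fun x => ENNReal.ofReal
    ((Real.sqrt ((2 * Real.pi) ^ d * R.det))⁻¹ *
      Real.exp (-(∑ i, ∑ j, x i * R⁻¹ i j * x j) / 2))

section

open Matrix

/-- If `D` is the derivative of `G` in direction `v`, off countably many points of each line
parallel to `v`, and both are integrable, then `D` has integral zero. -/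
theorem integral_lineDeriv_eq_zero_of_off_countable {E : Type*} [NormedAddCommGroup E]
    [NormedSpace ℝ E] [FiniteDimensional ℝ E] [MeasurableSpace E] [BorelSpace E]
    (μ : Measure E) [μ.IsAddHaarMeasure] {G D : E → ℝ} (v : E)
    (hGc : Continuous G) (hG : Integrable G μ) (hD : Integrable D μ)
    (hderiv : ∀ x, ∃ s : Set ℝ, s.Countable ∧
      ∀ t ∉ s, HasDerivAt (fun t : ℝ => G (x + t • v)) (D (x + t • v)) t) :
    ∫ x, D x ∂μ = 0 := by
  set ν : Measure ℝ := volume.restrict (Set.Ioc 0 1)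
  have hshear : MeasurePreserving (fun p : ℝ × E => (p.1, p.2 + p.1 • v))
      (ν.prod μ) (ν.prod μ) := by
    refine (MeasurePreserving.id ν).skew_product (g := fun t x => x + t • v) ?_ ?_
    · exact (continuous_snd.add (continuous_fst.smul continuous_const)).measurable
    · exact Filter.Eventually.of_forall fun t => map_add_right_eq_self μ (t • v)
  have hprod : Integrable (fun p : ℝ × E => D (p.2 + p.1 • v)) (ν.prod μ) :=
    hshear.integrable_comp_of_integrable (hD.comp_snd ν)
  have hswap : ∫ x, ∫ t, D (x + t • v) ∂ν ∂μ = ∫ t, ∫ x, D (x + t • v) ∂μ ∂ν :=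
    integral_integral_swap (f := fun x t => D (x + t • v)) hprod.swap
  have hright : ∫ t, ∫ x, D (x + t • v) ∂μ ∂ν = ∫ x, D x ∂μ := by
    simp [integral_add_right_eq_self, ν]
  have hleft : ∀ᵐ x ∂μ, ∫ t, D (x + t • v) ∂ν = G (x + v) - G x := by
    filter_upwards [hprod.swap.prod_right_ae] with x hx
    obtain ⟨s, hs, hd⟩ := hderiv x
    have h := integral_eq_of_hasDerivAt_off_countable (a := 0) (b := 1)
      (fun t : ℝ => G (x + t • v)) (fun t => D (x + t • v)) hs
      (by fun_prop) (fun t ht => hd t ht.2)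
      ((intervalIntegrable_iff_integrableOn_Ioc_of_le zero_le_one).2 hx)
    rw [intervalIntegral.integral_of_le zero_le_one] at h
    simpa using h
  rw [← hright, ← hswap, integral_congr_ae hleft, integral_sub (hG.comp_add_right v) hG,
    integral_add_right_eq_self, sub_self]

theorem Matrix.PosDef.exists_inv_eq_transpose_mul_self {ι : Type*} [Fintype ι] [DecidableEq ι]
    {R : Matrix ι ι ℝ} (hR : R.PosDef) : ∃ C : Matrix ι ι ℝ, R⁻¹ = Cᵀ * C ∧ C.det ≠ 0 := by
  open scoped MatrixOrder in
  obtain ⟨C, hC⟩ := CStarAlgebra.nonneg_iff_eq_star_mul_self.mp hR.inv.posSemidef.nonneg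
  refine ⟨C, by simpa [star_eq_conjTranspose] using hC, fun h0 => ?_⟩
  have := hR.inv.det_pos
  simp [hC, h0] at this

theorem sum_sum_mul_eq_sum_mulVec_sq {ι : Type*} [Fintype ι] {P C : Matrix ι ι ℝ}
    (h : P = Cᵀ * C) (x : ι → ℝ) :
    ∑ i, ∑ j, x i * P i j * x j = ∑ i, (C *ᵥ x) i ^ 2 := by
  have h1 : ∑ i, ∑ j, x i * P i j * x j = x ⬝ᵥ P *ᵥ x := by
    simp [dotProduct, mulVec, Finset.mul_sum, mul_assoc]
  rw [h1, h, ← mulVec_mulVec, dotProduct_mulVec, vecMul_transpose]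
  simp [dotProduct, sq]

theorem exists_mul_sum_sq_le_sum_sum_inv {ι : Type*} [Fintype ι] [DecidableEq ι]
    {R : Matrix ι ι ℝ} (hR : R.PosDef) :
    ∃ l : ℝ, 0 < l ∧ ∀ x : ι → ℝ, l * ∑ i, x i ^ 2 ≤ ∑ i, ∑ j, x i * R⁻¹ i j * x j := by
  obtain ⟨C, hC, hdet⟩ := hR.exists_inv_eq_transpose_mul_self
  set K : ℝ := ∑ i, ∑ j, C⁻¹ i j ^ 2
  have hK : 0 ≤ K := by positivity
  refine ⟨(K + 1)⁻¹, by positivity, fun x => ?_⟩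
  rw [sum_sum_mul_eq_sum_mulVec_sq hC, inv_mul_le_iff₀ (by positivity)]
  set y := C *ᵥ x with hy
  have hx : x = C⁻¹ *ᵥ y := by
    rw [hy, mulVec_mulVec, nonsing_inv_mul _ (isUnit_iff_ne_zero.2 hdet), one_mulVec]
  have hy0 : 0 ≤ ∑ j, y j ^ 2 := by positivity
  calc ∑ i, x i ^ 2 ≤ ∑ i, (∑ j, C⁻¹ i j ^ 2) * ∑ j, y j ^ 2 := by
        refine Finset.sum_le_sum fun i _ => ?_
        rw [hx]
        exact Finset.sum_mul_sq_le_sq_mul_sq _ _ _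
    _ = K * ∑ j, y j ^ 2 := by rw [← Finset.sum_mul]
    _ ≤ (K + 1) * ∑ j, y j ^ 2 := by linarith

/-- The density of the centered Gaussian measure with covariance `R`. -/
noncomputable def gaussianDensity (d : ℕ) (R : Matrix (Fin d) (Fin d) ℝ) (x : Fin d → ℝ) : ℝ :=
  (Real.sqrt ((2 * Real.pi) ^ d * R.det))⁻¹ *
      Real.exp (-(∑ i, ∑ j, x i * R⁻¹ i j * x j) / 2)

variable {d : ℕ} {R : Matrix (Fin d) (Fin d) ℝ}

theorem gaussianDensity_nonneg (x : Fin d → ℝ) : 0 ≤ gaussianDensity d R x := by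
  unfold gaussianDensity; positivity

theorem continuous_gaussianDensity : Continuous (gaussianDensity d R) := by
  unfold gaussianDensity; fun_prop

theorem integral_gaussianOfCov (g : (Fin d → ℝ) → ℝ) :
    ∫ x, g x ∂(gaussianOfCov d R) = ∫ x, gaussianDensity d R x * g x := by
  have hm : Measurable fun x => ENNReal.ofReal (gaussianDensity d R x) :=
    continuous_gaussianDensity.measurable.ennreal_ofReal
  have h := integral_withDensity_eq_integral_toReal_smul hm
    (Filter.Eventually.of_forall fun _ => ENNReal.ofReal_lt_top) (μ := volume) g
  simp only [ENNReal.toReal_ofReal (gaussianDensity_nonneg _), smul_eq_mul] at h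
  exact h

theorem integral_gaussianDensity (hR : R.PosDef) : ∫ x, gaussianDensity d R x = 1 := by
  obtain ⟨C, hC, hdet⟩ := hR.exists_inv_eq_transpose_mul_self
  have hstd : ∫ y : Fin d → ℝ, Real.exp (-(∑ i, y i ^ 2) / 2) = √(2 * Real.pi) ^ d := by
    have h1 : ∀ y : Fin d → ℝ, Real.exp (-(∑ i, y i ^ 2) / 2)
        = ∏ i, Real.exp (-(1 / 2) * y i ^ 2) := fun y => by
      rw [← Real.exp_sum, ← Finset.mul_sum]
      ring_nf
    simp_rw [h1]
    rw [integral_fintype_prod_volume_eq_prod (fun _ t => Real.exp (-(1 / 2) * t ^ 2))]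
    simp_rw [integral_gaussian]
    simp [mul_comm]
  have hmap : ∫ x : Fin d → ℝ, Real.exp (-(∑ i, (C *ᵥ x) i ^ 2) / 2)
      = |C.det|⁻¹ * √(2 * Real.pi) ^ d := by
    have h := integral_map (μ := volume) (φ := Matrix.toLin' C)
      (Matrix.toLin' C).continuous_of_finiteDimensional.aemeasurable
      (f := fun y => Real.exp (-(∑ i, y i ^ 2) / 2))
      (Continuous.aestronglyMeasurable (by fun_prop))
    rw [Real.map_matrix_volume_pi_eq_smul_volume_pi hdet, integral_smul_measure, hstd] at h
    simpa [abs_inv] using h.symm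
  have hdetR : R.det = (|C.det|⁻¹) ^ 2 := by
    have h := congrArg Matrix.det hC
    rw [det_nonsing_inv, Ring.inverse_eq_inv', det_mul, det_transpose] at h
    rw [inv_pow, sq_abs, sq, ← h, inv_inv]
  unfold gaussianDensity
  simp_rw [sum_sum_mul_eq_sum_mulVec_sq hC]
  rw [integral_const_mul, hmap, hdetR, Real.sqrt_mul (by positivity), Real.sqrt_sq (by positivity)]
  have h2 : √((2 * Real.pi) ^ d) = √(2 * Real.pi) ^ d := by
    rw [← Real.sqrt_sq (by positivity : 0 ≤ √(2 * Real.pi) ^ d), ← pow_mul, mul_comm d 2, pow_mul,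
      Real.sq_sqrt (by positivity)]
  have h3 : √(2 * Real.pi) ^ d ≠ 0 := by positivity
  have h4 : |C.det| ≠ 0 := by simpa using hdet
  rw [h2]
  field_simp

theorem integrable_gaussianDensity_mul (hR : R.PosDef) {g : (Fin d → ℝ) → ℝ}
    (hgm : Measurable g) {K : ℝ} {m : ℕ}
    (hg : ∀ x, |g x| ≤ K * (1 + √(∑ i, x i ^ 2)) ^ m) :
    Integrable fun x => gaussianDensity d R x * g x := by
  obtain ⟨l, hl, hq⟩ := exists_mul_sum_sq_le_sum_sum_inv hR
  have hK : 0 ≤ K := by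
    have h := (abs_nonneg _).trans (hg 0)
    simpa using h
  set Z : ℝ := (√((2 * Real.pi) ^ d * R.det))⁻¹
  have hZ : 0 ≤ Z := by positivity
  set A : ℝ := Z * K * (m.factorial * Real.exp (1 + 1 / l))
  have hdom : Integrable fun x : Fin d → ℝ => A * ∏ i, Real.exp (-(l / 4) * x i ^ 2) :=
    (Integrable.fintype_prod (f := fun _ t => Real.exp (-(l / 4) * t ^ 2))
      fun _ => integrable_exp_neg_mul_sq (by positivity)).const_mul A
  refine hdom.mono' (continuous_gaussianDensity.measurable.mul hgm).aestronglyMeasurable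
    (Filter.Eventually.of_forall fun x => ?_)
  set r := √(∑ i, x i ^ 2) with hr
  have hr0 : 0 ≤ r := Real.sqrt_nonneg _
  have hr2 : r ^ 2 = ∑ i, x i ^ 2 := Real.sq_sqrt (by positivity)
  have hprod : ∏ i, Real.exp (-(l / 4) * x i ^ 2) = Real.exp (-(l / 4) * r ^ 2) := by
    rw [← Real.exp_sum, ← Finset.mul_sum, hr2]
  have hpow : (1 + r) ^ m ≤ m.factorial * Real.exp (1 + r) := by
    have h := Real.pow_div_factorial_le_exp (1 + r) (by positivity) m
    rwa [div_le_iff₀' (by positivity)] at h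
  have hamgm : r ≤ l / 4 * r ^ 2 + 1 / l := by
    have h : l / 4 * r ^ 2 + 1 / l - r = (l * r - 2) ^ 2 / (4 * l) := by field_simp; ring
    have : 0 ≤ (l * r - 2) ^ 2 / (4 * l) := by positivity
    linarith
  have hexp : Real.exp (-(∑ i, ∑ j, x i * R⁻¹ i j * x j) / 2) * Real.exp (1 + r)
      ≤ Real.exp (1 + 1 / l) * Real.exp (-(l / 4) * r ^ 2) := by
    rw [← Real.exp_add, ← Real.exp_add, Real.exp_le_exp]
    have := hq x
    rw [← hr2] at this
    linarith
  rw [hprod, norm_mul, Real.norm_of_nonneg (gaussianDensity_nonneg x), Real.norm_eq_abs]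
  unfold gaussianDensity
  calc _ ≤ Z * Real.exp (-(∑ i, ∑ j, x i * R⁻¹ i j * x j) / 2) *
        (K * (m.factorial * Real.exp (1 + r))) := by
        gcongr
        exact (hg x).trans (by gcongr)
    _ = Z * K * m.factorial *
        (Real.exp (-(∑ i, ∑ j, x i * R⁻¹ i j * x j) / 2) * Real.exp (1 + r)) := by ring
    _ ≤ Z * K * m.factorial * (Real.exp (1 + 1 / l) * Real.exp (-(l / 4) * r ^ 2)) := by gcongr
    _ = _ := by ring

theorem hasDerivAt_gaussianDensity_line (hR : R.PosDef) (k : Fin d) (x : Fin d → ℝ) (t : ℝ) :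
    HasDerivAt (fun t : ℝ => gaussianDensity d R (x + t • R k))
      (-((x + t • R k) k) * gaussianDensity d R (x + t • R k)) t := by
  have hsymm : Rᵀ = R := by simpa using hR.isHermitian.eq
  have hdet : IsUnit R.det := hR.det_pos.ne'.isUnit
  have hv : R k = R *ᵥ Pi.single k 1 := by
    rw [mulVec_single_one]
    funext i
    simp only [col_apply]
    rw [← transpose_apply R, hsymm]
  have hPv : R⁻¹ *ᵥ R k = Pi.single k 1 := by
    rw [hv, mulVec_mulVec, nonsing_inv_mul _ hdet, one_mulVec]
  have hPsymm : (R⁻¹)ᵀ = R⁻¹ := by rw [transpose_nonsing_inv, hsymm]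
  have hquad : ∀ s : ℝ, ∑ i, ∑ j, (x + s • R k) i * R⁻¹ i j * (x + s • R k) j
      = x ⬝ᵥ R⁻¹ *ᵥ x + 2 * s * x k + s ^ 2 * R k k := fun s => by
    have h1 : ∀ y : Fin d → ℝ, ∑ i, ∑ j, y i * R⁻¹ i j * y j = y ⬝ᵥ R⁻¹ *ᵥ y := fun y => by
      simp [dotProduct, mulVec, Finset.mul_sum, mul_assoc]
    have h2 : R k ⬝ᵥ R⁻¹ *ᵥ x = x k := by
      rw [dotProduct_mulVec, ← mulVec_transpose, hPsymm, hPv, single_one_dotProduct]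
    rw [h1, mulVec_add, mulVec_smul, hPv, add_dotProduct, dotProduct_add, dotProduct_add,
      smul_dotProduct, smul_dotProduct, h2, dotProduct_smul, dotProduct_smul]
    simp
    ring
  unfold gaussianDensity
  simp_rw [hquad]
  have h := ((((((hasDerivAt_id t).const_mul 2).mul_const (x k)).const_add
    (x ⬝ᵥ R⁻¹ *ᵥ x)).add (((hasDerivAt_id t).pow 2).mul_const (R k k))).neg.div_const 2).exp.const_mul
    (√((2 * Real.pi) ^ d * R.det))⁻¹
  refine h.congr_deriv ?_
  simp
  ring

theorem continuous_indicator_halfSpace_mul {a : Fin d → ℝ} {c : ℝ} {f : (Fin d → ℝ) → ℝ}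
    (hf : Continuous f) (hf0 : ∀ x, ∑ i, a i * x i = c → f x = 0) :
    Continuous fun x => (if c ≤ ∑ i, a i * x i then (1 : ℝ) else 0) * f x := by
  simp_rw [ite_mul, one_mul, zero_mul]
  exact hf.if_le continuous_const continuous_const (by fun_prop) fun x hx => hf0 x hx.symm

theorem exists_countable_hasDerivAt_indicator_halfSpace_mul {a : Fin d → ℝ} {c : ℝ}
    {f : (Fin d → ℝ) → ℝ} (hf : Differentiable ℝ f) (v x : Fin d → ℝ) :
    ∃ s : Set ℝ, s.Countable ∧ ∀ t ∉ s,
      HasDerivAt (fun t : ℝ =>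
          (if c ≤ ∑ i, a i * (x + t • v) i then (1 : ℝ) else 0) * f (x + t • v))
        ((if c ≤ ∑ i, a i * (x + t • v) i then (1 : ℝ) else 0) * fderiv ℝ f (x + t • v) v) t := by
  have hline : ∀ t : ℝ, HasDerivAt (fun t : ℝ => f (x + t • v)) (fderiv ℝ f (x + t • v) v) t :=
    fun t => (hf _).hasFDerivAt.comp_hasDerivAt t
      (by simpa using ((hasDerivAt_id t).smul_const v).const_add x)
  set u : ℝ → ℝ := fun t => ∑ i, a i * (x + t • v) i with hu
  have haff : ∀ t, u t = ∑ i, a i * x i + t * ∑ i, a i * v i := fun t => by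
    simp only [hu, Pi.add_apply, Pi.smul_apply, smul_eq_mul, mul_add, Finset.sum_add_distrib,
      Finset.mul_sum]
    congr 1
    exact Finset.sum_congr rfl fun i _ => by ring
  by_cases hv : ∑ i, a i * v i = 0
  · refine ⟨∅, Set.countable_empty, fun t _ => ?_⟩
    have hconst : ∀ s, u s = u t := fun s => by simp [haff, hv]
    change HasDerivAt (fun s => (if c ≤ u s then (1 : ℝ) else 0) * f (x + s • v))
      ((if c ≤ u t then (1 : ℝ) else 0) * fderiv ℝ f (x + t • v) v) t
    simp_rw [hconst]
    exact (hline t).const_mul _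
  · refine ⟨{t | u t = c}, Set.Subsingleton.countable fun s hs t ht => ?_, fun t ht => ?_⟩
    · have h : u s = u t := Eq.trans hs (Eq.symm ht)
      rw [haff, haff] at h
      exact mul_right_cancel₀ hv (add_left_cancel h)
    · have hcont : Continuous u := by fun_prop
      refine ((hline t).const_mul (if c ≤ u t then (1 : ℝ) else 0)).congr_of_eventuallyEq ?_
      rcases lt_or_gt_of_ne (show u t ≠ c from ht) with hlt | hgt
      · filter_upwards [hcont.continuousAt.eventually_lt_const hlt] with s hs
        change (if c ≤ u s then (1 : ℝ) else 0) * _ = _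
        rw [if_neg hs.not_ge, if_neg hlt.not_ge]
      · filter_upwards [hcont.continuousAt.eventually_const_lt hgt] with s hs
        change (if c ≤ u s then (1 : ℝ) else 0) * _ = _
        rw [if_pos hs.le, if_pos hgt.le]

/-- Gaussian integration by parts on the half-space `c ≤ ⟨a, x⟩`, for functions vanishing on its
boundary. -/
theorem integral_mul_halfSpace_gaussianOfCov (hR : R.PosDef) (k : Fin d) (a : Fin d → ℝ) (c : ℝ)
    (f : (Fin d → ℝ) → ℝ) (hf : ContDiff ℝ 1 f)
    (hf0 : ∀ x : Fin d → ℝ, (∑ i, a i * x i) = c → f x = 0)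
    (hgrowth : ∃ C : ℝ, ∃ m : ℕ, ∀ x : Fin d → ℝ,
      |f x| ≤ C * (1 + Real.sqrt (∑ i, (x i) ^ 2)) ^ m)
    (hgrowth' : ∀ j : Fin d, ∃ C : ℝ, ∃ m : ℕ, ∀ x : Fin d → ℝ,
      |fderiv ℝ f x (Pi.single j 1)| ≤ C * (1 + Real.sqrt (∑ i, (x i) ^ 2)) ^ m) :
    ∫ x : Fin d → ℝ,
        x k * f x * (if c ≤ ∑ i, a i * x i then (1 : ℝ) else 0) ∂(gaussianOfCov d R)
      = ∑ i : Fin d, R k i *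
          ∫ x : Fin d → ℝ,
            (if c ≤ ∑ i, a i * x i then (1 : ℝ) else 0) * fderiv ℝ f x (Pi.single i 1)
            ∂(gaussianOfCov d R) := by
  set χ : (Fin d → ℝ) → ℝ := fun x => if c ≤ ∑ i, a i * x i then (1 : ℝ) else 0 with hχ
  have hχm : Measurable χ := Measurable.ite
    (measurableSet_le measurable_const (by fun_prop)) measurable_const measurable_const
  have hχ0 : ∀ x y, |χ x * y| ≤ |y| := fun x y => by
    by_cases h : c ≤ ∑ i, a i * x i <;> simp [hχ, h]
  have hfd : ∀ w, Continuous fun x => fderiv ℝ f x w := fun w =>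
    (hf.continuous_fderiv one_ne_zero).clm_apply continuous_const
  obtain ⟨K, m, hK⟩ := hgrowth
  have hG : Integrable fun x => gaussianDensity d R x * (χ x * f x) :=
    integrable_gaussianDensity_mul hR (hχm.mul hf.continuous.measurable)
      fun x => (hχ0 x _).trans (hK x)
  have hL : Integrable fun x => gaussianDensity d R x * (x k * f x * χ x) := by
    refine integrable_gaussianDensity_mul hR (K := K) (m := m + 1)
      (((measurable_pi_apply k).mul hf.continuous.measurable).mul hχm) fun x => ?_
    have hxk : |x k| ≤ 1 + √(∑ i, x i ^ 2) := by
      have h : |x k| ≤ √(∑ i, x i ^ 2) :=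
        Real.abs_le_sqrt (Finset.single_le_sum (f := fun i => x i ^ 2)
          (fun i _ => sq_nonneg _) (Finset.mem_univ k))
      linarith
    calc |x k * f x * χ x| ≤ |x k| * |f x| := by
          rw [mul_comm, ← abs_mul]; exact hχ0 x _
      _ ≤ (1 + √(∑ i, x i ^ 2)) * (K * (1 + √(∑ i, x i ^ 2)) ^ m) := by
          gcongr
          exact hK x
      _ = _ := by ring
  have hP : ∀ i, Integrable fun x =>
      gaussianDensity d R x * (χ x * fderiv ℝ f x (Pi.single i 1)) := fun i => by
    obtain ⟨K, m, hK⟩ := hgrowth' i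
    exact integrable_gaussianDensity_mul hR (hχm.mul (hfd _).measurable)
      fun x => (hχ0 x _).trans (hK x)
  have hsum : ∀ x, fderiv ℝ f x (R k) = ∑ i, R k i * fderiv ℝ f x (Pi.single i 1) := fun x => by
    conv_lhs => rw [pi_eq_sum_univ' (R k)]
    simp [map_sum]
  have hS : Integrable fun x =>
      ∑ i, R k i * (gaussianDensity d R x * (χ x * fderiv ℝ f x (Pi.single i 1))) :=
    integrable_finsetSum _ fun i _ => (hP i).const_mul _
  have hzero := integral_lineDeriv_eq_zero_of_off_countable volume (R k)
    (continuous_gaussianDensity.mul (continuous_indicator_halfSpace_mul hf.continuous hf0))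
    hG (hS.sub hL) fun x => by
      obtain ⟨s, hs, hd⟩ := exists_countable_hasDerivAt_indicator_halfSpace_mul
        (hf.differentiable one_ne_zero) (R k) x
      refine ⟨s, hs, fun t ht => ?_⟩
      refine ((hasDerivAt_gaussianDensity_line hR k x t).mul (hd t ht)).congr_deriv ?_
      simp only [hχ, Pi.sub_apply, hsum, Finset.mul_sum]
      rw [sub_eq_add_neg, add_comm]
      congr 1
      · exact Finset.sum_congr rfl fun i _ => by ring
      · ring
  rw [integral_sub' hS hL, integral_finsetSum _ fun i _ => (hP i).const_mul _, sub_eq_zero] at hzero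
  simp_rw [integral_const_mul] at hzero
  simp_rw [integral_gaussianOfCov]
  exact hzero.symm

theorem integral_mul_eval_gaussianOfCov (hR : R.PosDef) (k i : Fin d) :
    ∫ x : Fin d → ℝ, x k * x i ∂(gaussianOfCov d R) = R k i := by
  have hfd : ∀ x : Fin d → ℝ, fderiv ℝ (fun x : Fin d → ℝ => x i) x
      = ContinuousLinearMap.proj (R := ℝ) (φ := fun _ : Fin d => ℝ) i := fun x =>
    (ContinuousLinearMap.proj (R := ℝ) (φ := fun _ : Fin d => ℝ) i).fderiv
  have h := integral_mul_halfSpace_gaussianOfCov hR k 0 (-1) (fun x => x i) (by fun_prop)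
    (fun x hx => by norm_num at hx) ⟨1, 1, fun x => by
      have h : |x i| ≤ √(∑ i, x i ^ 2) :=
        Real.abs_le_sqrt (Finset.single_le_sum (f := fun i => x i ^ 2)
          (fun i _ => sq_nonneg _) (Finset.mem_univ i))
      linarith⟩
    (fun j => ⟨1, 0, fun x => by
      rw [hfd]
      by_cases hij : i = j <;> simp [hij]⟩)
  have hmass : ∀ r : ℝ, ∫ _ : Fin d → ℝ, r ∂(gaussianOfCov d R) = r := fun r => by
    rw [integral_gaussianOfCov, integral_mul_const, integral_gaussianDensity hR, one_mul]
  simp_rw [hfd] at h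
  simpa [hmass, Pi.single_apply] using h

end

theorem stmt11 (d : ℕ) (hd : 0 < d) (R : Matrix (Fin d) (Fin d) ℝ)
    (hR : R.PosDef) (a : Fin d → ℝ) (c : ℝ)
    (f : (Fin d → ℝ) → ℝ) (hf : ContDiff ℝ 1 f)
    (hf0 : ∀ x : Fin d → ℝ, (∑ i, a i * x i) = c → f x = 0)
    (hgrowth : ∃ C : ℝ, ∃ m : ℕ, ∀ x : Fin d → ℝ,
      |f x| ≤ C * (1 + Real.sqrt (∑ i, (x i) ^ 2)) ^ m)
    (hgrowth' : ∀ j : Fin d, ∃ C : ℝ, ∃ m : ℕ, ∀ x : Fin d → ℝ,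
      |fderiv ℝ f x (Pi.single j 1)| ≤ C * (1 + Real.sqrt (∑ i, (x i) ^ 2)) ^ m) :
    (∫ x : Fin d → ℝ,
        x ⟨0, hd⟩ * f x * (if c ≤ ∑ i, a i * x i then (1 : ℝ) else 0)
        ∂(gaussianOfCov d R)
      = ∑ i : Fin d, R ⟨0, hd⟩ i *
          ∫ x : Fin d → ℝ,
            (if c ≤ ∑ i, a i * x i then (1 : ℝ) else 0) * fderiv ℝ f x (Pi.single i 1)
            ∂(gaussianOfCov d R)) ∧
    ∀ i : Fin d, R ⟨0, hd⟩ i = ∫ x : Fin d → ℝ, x ⟨0, hd⟩ * x i ∂(gaussianOfCov d R) := by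
  exact ⟨integral_mul_halfSpace_gaussianOfCov hR _ a c f hf hf0 hgrowth hgrowth',
    fun i => (integral_mul_eval_gaussianOfCov hR _ i).symm⟩
end
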